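/- Let H be a finite-dimensional complex Hilbert space, let H₁, H₂ : [a, b] → B(H) be integrable with H_j(s) self-adjoint, and suppose the averages agree: ∫_a^b H₁(s) ds = ∫_a^b H₂(s) ds. Let U₁, U₂ be the corresponding propagators, U_j(t) = 1 − i ∫_a^t H_j(s)U_j(s) ds. Then ‖U₁(b) − U₂(b)‖ ≤ ∫_a^b ∫_a^s ( ‖H₁(r)‖·‖H₁(s)‖ + ‖H₂(r)‖·‖H₂(s)‖ ) dr ds, where ‖·‖ is the operator norm. -/

import Mathlib

open MeasureTheory Filter Topology

noncomputable section

/-- Absolute continuity is inherited by a function whose increments are dominated. -/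
lemma AbsolutelyContinuousOnInterval.of_dist_le {X Y : Type*} [PseudoMetricSpace X]
    [PseudoMetricSpace Y] {f : ℝ → X} {g : ℝ → Y} {a b : ℝ}
    (hf : AbsolutelyContinuousOnInterval f a b) (C : ℝ)
    (h : ∀ s ∈ Set.uIcc a b, ∀ t ∈ Set.uIcc a b, dist (g s) (g t) ≤ C * dist (f s) (f t)) :
    AbsolutelyContinuousOnInterval g a b := by
  refine squeeze_zero' (Eventually.of_forall fun E ↦ Finset.sum_nonneg fun i _ ↦ dist_nonneg)
    ?_ (by simpa using Tendsto.const_mul C hf)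
  filter_upwards [mem_inf_of_right (mem_principal_self _)] with E hE
  rw [Finset.mul_sum]
  exact Finset.sum_le_sum fun i hi ↦ h _ (hE.1 i hi).1 _ (hE.1 i hi).2

/-- The primitive of an interval integrable vector-valued function is absolutely continuous. -/
lemma IntervalIntegrable.absolutelyContinuousOnInterval_integral {F : Type*}
    [NormedAddCommGroup F] [NormedSpace ℝ F] {f : ℝ → F} {a b c : ℝ}
    (hf : IntervalIntegrable f volume a b) (hc : c ∈ Set.uIcc a b) :
    AbsolutelyContinuousOnInterval (fun x ↦ ∫ v in c..x, f v) a b := by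
  refine (hf.norm.absolutelyContinuousOnInterval_intervalIntegral hc).of_dist_le 1
    fun s hs t ht ↦ ?_
  have hcs : IntervalIntegrable f volume c s := hf.mono_set (Set.uIcc_subset_uIcc hc hs)
  have hct : IntervalIntegrable f volume c t := hf.mono_set (Set.uIcc_subset_uIcc hc ht)
  rw [one_mul, dist_eq_norm, dist_eq_norm, Real.norm_eq_abs,
    intervalIntegral.integral_interval_sub_left hcs hct,
    intervalIntegral.integral_interval_sub_left hcs.norm hct.norm]
  exact intervalIntegral.norm_integral_le_abs_integral_norm

/-- An absolutely continuous curve whose velocity is almost everywhere orthogonal to its position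
has constant norm. -/
lemma AbsolutelyContinuousOnInterval.norm_eq_left_of_ae_hasDerivAt {E : Type*}
    [NormedAddCommGroup E] [InnerProductSpace ℂ E] {u : ℝ → E} {a b : ℝ}
    (huac : AbsolutelyContinuousOnInterval u a b)
    (hd : ∀ᵐ s, s ∈ Set.uIcc a b → ∃ v, HasDerivAt u v s ∧
      inner ℂ (u s) v + inner ℂ v (u s) = 0) :
    ∀ t ∈ Set.uIcc a b, ‖u t‖ = ‖u a‖ := by
  obtain ⟨C, hC⟩ := huac.exists_bound
  have hfac : AbsolutelyContinuousOnInterval (fun t ↦ inner ℂ (u t) (u t)) a b := by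
    refine huac.of_dist_le (C + C) fun s hs t ht ↦ ?_
    rw [dist_eq_norm, dist_eq_norm]
    have : inner ℂ (u s) (u s) - inner ℂ (u t) (u t)
        = inner ℂ (u s) (u s - u t) + inner ℂ (u s - u t) (u t) := by
      simp only [inner_sub_left, inner_sub_right]; ring
    rw [this]
    calc _ ≤ ‖u s‖ * ‖u s - u t‖ + ‖u s - u t‖ * ‖u t‖ :=
          (norm_add_le _ _).trans (add_le_add (norm_inner_le_norm _ _) (norm_inner_le_norm _ _))
      _ ≤ C * ‖u s - u t‖ + ‖u s - u t‖ * C := by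
          gcongr
          · exact hC s hs
          · exact hC t ht
      _ = _ := by ring
  obtain ⟨c, hc⟩ := hfac.const_of_ae_hasDerivAt_zero (by
    filter_upwards [hd] with s hs hsI
    obtain ⟨v, hv, hv0⟩ := hs hsI
    exact hv0 ▸ hv.inner ℂ hv)
  intro t ht
  have h := (hc t ht).trans (hc a Set.left_mem_uIcc).symm
  simp only [inner_self_eq_norm_sq_to_K] at h
  have h' : ‖u t‖ ^ 2 = ‖u a‖ ^ 2 := by exact_mod_cast h
  exact (sq_eq_sq₀ (norm_nonneg _) (norm_nonneg _)).1 h'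

lemma intervalIntegrable_integral_norm_mul_norm {F : Type*} [NormedAddCommGroup F] {a b : ℝ}
    {H : ℝ → F} (hab : a ≤ b) (hH : IntegrableOn H (Set.Icc a b) volume) :
    IntervalIntegrable (fun s ↦ (∫ r in a..s, ‖H r‖) * ‖H s‖) volume a b := by
  rw [intervalIntegrable_iff_integrableOn_Icc_of_le hab]
  refine IntegrableOn.continuousOn_mul ?_ hH.norm isCompact_Icc
  rw [← Set.uIcc_of_le hab] at hH ⊢
  exact intervalIntegral.continuousOn_primitive_interval (Integrable.norm hH)

section Propagator

variable {E : Type*} [NormedAddCommGroup E] [InnerProductSpace ℂ E] [FiniteDimensional ℂ E]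
  {a b : ℝ} {H U : ℝ → E →L[ℂ] E}

lemma intervalIntegrable_comp_propagator (hab : a ≤ b)
    (hH : IntegrableOn H (Set.Icc a b) volume) (hUc : ContinuousOn U (Set.Icc a b)) :
    IntervalIntegrable (fun s ↦ H s ∘L U s) volume a b := by
  rw [intervalIntegrable_iff_integrableOn_Icc_of_le hab]
  exact hH.mul_continuousOn hUc isCompact_Icc

/-- The propagator of a self-adjoint Hamiltonian is isometric. -/
lemma norm_propagator_apply (hab : a ≤ b)
    (hH : IntegrableOn H (Set.Icc a b) volume)
    (hsa : ∀ s ∈ Set.Icc a b, IsSelfAdjoint (H s))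
    (hUc : ContinuousOn U (Set.Icc a b))
    (hU : ∀ t ∈ Set.Icc a b, U t = 1 - Complex.I • ∫ s in a..t, (H s) ∘L (U s))
    {t : ℝ} (ht : t ∈ Set.Icc a b) (x : E) : ‖U t x‖ = ‖x‖ := by
  have hint := intervalIntegrable_comp_propagator hab hH hUc
  have hI : Set.uIcc a b = Set.Icc a b := Set.uIcc_of_le hab
  have haI : a ∈ Set.uIcc a b := Set.left_mem_uIcc
  set W : ℝ → E →L[ℂ] E := fun t ↦ ∫ s in a..t, (H s) ∘L (U s) with hW
  have hWac : AbsolutelyContinuousOnInterval W a b :=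
    hint.absolutelyContinuousOnInterval_integral haI
  let u : ℝ → E := fun t ↦ x - Complex.I • W t x
  have hu : ∀ t ∈ Set.Icc a b, u t = U t x := fun t ht ↦ by simp [u, hU t ht, hW]
  have huac : AbsolutelyContinuousOnInterval u a b := by
    refine hWac.of_dist_le ‖x‖ fun s _ t _ ↦ ?_
    rw [dist_eq_norm, dist_eq_norm]
    have : u s - u t = -(Complex.I • (W s - W t) x) := by
      simp only [u, sub_apply, smul_sub]; abel
    rw [this, norm_neg, norm_smul, Complex.norm_I, one_mul, mul_comm]
    exact (W s - W t).le_opNorm x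
  have h := huac.norm_eq_left_of_ae_hasDerivAt (by
    filter_upwards [hint.ae_hasDerivAt_integral] with s hs hsI
    have hW' : HasDerivAt W (H s ∘L U s) s := hs hsI a haI
    have hWx : HasDerivAt (fun t ↦ W t x) (H s (U s x)) s :=
      ((ContinuousLinearMap.apply ℂ E x).restrictScalars ℝ).hasFDerivAt.comp_hasDerivAt s hW'
    have hsym : inner ℂ (H s (u s)) (u s) = inner ℂ (u s) (H s (u s)) :=
      (hsa s (hI ▸ hsI)).isSymmetric (u s) (u s)
    refine ⟨-(Complex.I • H s (u s)), ?_, ?_⟩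
    · rw [hu s (hI ▸ hsI)]
      exact (hWx.const_smul Complex.I).const_sub x
    · simp [inner_smul_left, inner_smul_right, hsym]) t (hI ▸ ht)
  rw [hu t ht] at h
  simpa [u, hW] using h

/-- First-order Dyson expansion of the propagator, with remainder estimate. -/
lemma norm_propagator_sub_first_order_le (hab : a ≤ b)
    (hH : IntegrableOn H (Set.Icc a b) volume)
    (hsa : ∀ s ∈ Set.Icc a b, IsSelfAdjoint (H s))
    (hUc : ContinuousOn U (Set.Icc a b))
    (hU : ∀ t ∈ Set.Icc a b, U t = 1 - Complex.I • ∫ s in a..t, (H s) ∘L (U s)) :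
    ‖U b - (1 - Complex.I • ∫ s in a..b, H s)‖ ≤
      ∫ s in a..b, (∫ r in a..s, ‖H r‖) * ‖H s‖ := by
  have hHi : IntervalIntegrable H volume a b :=
    (intervalIntegrable_iff_integrableOn_Icc_of_le hab).2 hH
  have hnorm : ∀ t ∈ Set.Icc a b, ‖U t‖ ≤ 1 := fun t ht ↦
    (U t).opNorm_le_bound zero_le_one fun x ↦ by
      rw [norm_propagator_apply hab hH hsa hUc hU ht x, one_mul]
  have hdev : ∀ t ∈ Set.Icc a b, ‖U t - 1‖ ≤ ∫ r in a..t, ‖H r‖ := fun t ht ↦ by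
    have : U t - 1 = -(Complex.I • ∫ s in a..t, (H s) ∘L (U s)) := by rw [hU t ht]; abel
    rw [this, norm_neg, norm_smul, Complex.norm_I, one_mul]
    refine intervalIntegral.norm_integral_le_of_norm_le ht.1 (ae_of_all _ fun s hs ↦ ?_)
      (hHi.norm.mono_set ?_)
    · calc ‖H s ∘L U s‖ ≤ ‖H s‖ * ‖U s‖ := ContinuousLinearMap.opNorm_comp_le _ _
        _ ≤ ‖H s‖ * 1 := by gcongr; exact hnorm s ⟨hs.1.le, hs.2.trans ht.2⟩
        _ = ‖H s‖ := mul_one _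
    · rw [Set.uIcc_of_le hab, Set.uIcc_of_le ht.1]
      exact Set.Icc_subset_Icc_right ht.2
  have hrem : U b - (1 - Complex.I • ∫ s in a..b, H s)
      = -(Complex.I • ∫ s in a..b, H s ∘L (U s - 1)) := by
    have : ∫ s in a..b, H s ∘L (U s - 1) = (∫ s in a..b, H s ∘L U s) - ∫ s in a..b, H s := by
      rw [← intervalIntegral.integral_sub (intervalIntegrable_comp_propagator hab hH hUc) hHi]
      refine intervalIntegral.integral_congr fun s _ ↦ ?_
      exact mul_sub_one (H s) (U s)
    rw [this, hU b (Set.right_mem_Icc.2 hab), smul_sub]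
    abel
  rw [hrem, norm_neg, norm_smul, Complex.norm_I, one_mul]
  refine intervalIntegral.norm_integral_le_of_norm_le hab (ae_of_all _ fun s hs ↦ ?_)
    (intervalIntegrable_integral_norm_mul_norm hab hH)
  calc ‖H s ∘L (U s - 1)‖ ≤ ‖H s‖ * ‖U s - 1‖ := ContinuousLinearMap.opNorm_comp_le _ _
    _ ≤ ‖H s‖ * ∫ r in a..s, ‖H r‖ := by gcongr; exact hdev s ⟨hs.1.le, hs.2⟩
    _ = _ := mul_comm _ _

end Propagator

/-- let `H` be a finite-dimensional complex Hilbert space, `H₁, H₂` integrable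
self-adjoint-valued Hamiltonians on `[a, b]` with equal averages `∫_a^b H₁ = ∫_a^b H₂`, and
`U₁, U₂` the corresponding propagators `U_j(t) = 1 − i ∫_a^t H_j(s) U_j(s) ds`.  Then
`‖U₁(b) − U₂(b)‖ ≤ ∫_a^b ∫_a^s (‖H₁(r)‖·‖H₁(s)‖ + ‖H₂(r)‖·‖H₂(s)‖) dr ds`. -/
theorem statement16
    {E : Type*} [NormedAddCommGroup E] [InnerProductSpace ℂ E] [FiniteDimensional ℂ E]
    (a b : ℝ) (hab : a ≤ b) (H₁ H₂ : ℝ → E →L[ℂ] E)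
    (hH₁ : IntegrableOn H₁ (Set.Icc a b) volume)
    (hH₂ : IntegrableOn H₂ (Set.Icc a b) volume)
    (hsa₁ : ∀ s ∈ Set.Icc a b, IsSelfAdjoint (H₁ s))
    (hsa₂ : ∀ s ∈ Set.Icc a b, IsSelfAdjoint (H₂ s))
    (havg : ∫ s in a..b, H₁ s = ∫ s in a..b, H₂ s)
    (U₁ U₂ : ℝ → E →L[ℂ] E)
    (hU₁c : ContinuousOn U₁ (Set.Icc a b)) (hU₂c : ContinuousOn U₂ (Set.Icc a b))
    (hU₁ : ∀ t ∈ Set.Icc a b,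
      U₁ t = 1 - Complex.I • ∫ s in a..t, (H₁ s) ∘L (U₁ s))
    (hU₂ : ∀ t ∈ Set.Icc a b,
      U₂ t = 1 - Complex.I • ∫ s in a..t, (H₂ s) ∘L (U₂ s)) :
    ‖U₁ b - U₂ b‖ ≤
      ∫ s in a..b, ∫ r in a..s, (‖H₁ r‖ * ‖H₁ s‖ + ‖H₂ r‖ * ‖H₂ s‖) := by
  have hrhs : ∫ s in a..b, ∫ r in a..s, (‖H₁ r‖ * ‖H₁ s‖ + ‖H₂ r‖ * ‖H₂ s‖) =
      (∫ s in a..b, (∫ r in a..s, ‖H₁ r‖) * ‖H₁ s‖) +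
        ∫ s in a..b, (∫ r in a..s, ‖H₂ r‖) * ‖H₂ s‖ := by
    rw [← intervalIntegral.integral_add (intervalIntegrable_integral_norm_mul_norm hab hH₁)
      (intervalIntegrable_integral_norm_mul_norm hab hH₂)]
    refine intervalIntegral.integral_congr fun s hs ↦ ?_
    rw [Set.uIcc_of_le hab] at hs
    have key : ∀ H : ℝ → E →L[ℂ] E, IntegrableOn H (Set.Icc a b) volume →
        IntervalIntegrable (fun r ↦ ‖H r‖) volume a s := fun H hH ↦
      (intervalIntegrable_iff_integrableOn_Icc_of_le hs.1).2
        (hH.mono_set (Set.Icc_subset_Icc_right hs.2)).norm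
    rw [intervalIntegral.integral_add ((key H₁ hH₁).mul_const _) ((key H₂ hH₂).mul_const _),
      intervalIntegral.integral_mul_const, intervalIntegral.integral_mul_const]
  have h₁ := norm_propagator_sub_first_order_le hab hH₁ hsa₁ hU₁c hU₁
  have h₂ := norm_propagator_sub_first_order_le hab hH₂ hsa₂ hU₂c hU₂
  rw [← havg] at h₂
  rw [hrhs, ← sub_sub_sub_cancel_right (U₁ b) (U₂ b) (1 - Complex.I • ∫ s in a..b, H₁ s)]
  exact (norm_sub_le _ _).trans (add_le_add h₁ h₂)

end
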